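/- Let u be a classical solution of the wave equation on 0 < x < ℓ(t) with u(0,t) = 0 and the damped boundary condition (1 + η ℓ′(t)) u_x(ℓ(t),t) + (η + ℓ′(t)) u_t(ℓ(t),t) = 0, with η > 0, η ≠ 1. If the interval is expanding, i.e. 0 ≤ ℓ′(t) < 1 for t in an interval [t₁,t₂], then E′(t) ≤ 0 for all t ∈ [t₁,t₂]; in particular the energy is nonincreasing on [t₁,t₂]. -/

import Mathlib

open Filter Topology in
/-- Near `t`, the segments joining `L t` to `L s` at height `s` stay in any neighbourhood of
`(L t, t)`. -/
lemma eventually_forall_uIcc_of_eventually_nhds {L : ℝ → ℝ} {t : ℝ} (hL : ContinuousAt L t)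
    {p : ℝ × ℝ → Prop} (hp : ∀ᶠ z in 𝓝 (L t, t), p z) :
    ∀ᶠ s in 𝓝 t, ∀ x ∈ Set.uIcc (L t) (L s), p (x, s) := by
  obtain ⟨r, hr, hball⟩ := Metric.eventually_nhds_iff.1 hp
  filter_upwards [Metric.ball_mem_nhds t hr, hL (Metric.ball_mem_nhds (L t) hr)] with s hs hLs x hx
  refine hball ?_
  rw [Prod.dist_eq, max_lt_iff]
  refine ⟨?_, hs⟩
  have hLs' : |L s - L t| < r := by simpa [Real.dist_eq] using hLs
  exact (Set.abs_sub_left_of_mem_uIcc hx).trans_lt hLs'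

open Filter Topology in
/-- Derivative of the integral over the segment swept by a moving endpoint. -/
lemma hasDerivAt_integral_moving_endpoint {F : ℝ × ℝ → ℝ} {U : Set (ℝ × ℝ)} (hU : IsOpen U)
    (hF : ContinuousOn F U) {L : ℝ → ℝ} {a t : ℝ} (hL : HasDerivAt L a t) (hLt : (L t, t) ∈ U) :
    HasDerivAt (fun s => ∫ x in (L t)..(L s), F (x, s)) (a * F (L t, t)) t := by
  have hFt : ContinuousAt F (L t, t) := hF.continuousAt (hU.mem_nhds hLt)
  have hsmall : (fun s => (∫ x in (L t)..(L s), F (x, s)) - (L s - L t) * F (L t, t))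
      =o[𝓝 t] fun s => L s - L t := by
    refine Asymptotics.isLittleO_iff.2 fun ε hε => ?_
    filter_upwards [eventually_forall_uIcc_of_eventually_nhds hL.continuousAt
      ((hU.eventually_mem hLt).and (hFt (Metric.closedBall_mem_nhds _ hε)))] with s hs
    have hint : IntervalIntegrable (fun x => F (x, s)) MeasureTheory.volume (L t) (L s) :=
      (hF.comp (by fun_prop) fun x hx => (hs x hx).1).intervalIntegrable
    have heq : (∫ x in (L t)..(L s), F (x, s)) - (L s - L t) * F (L t, t)
        = ∫ x in (L t)..(L s), (F (x, s) - F (L t, t)) := by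
      rw [intervalIntegral.integral_sub hint intervalIntegrable_const]
      simp
    rw [heq]
    refine intervalIntegral.norm_integral_le_of_norm_le_const fun x hx => ?_
    simpa [Real.dist_eq] using (hs x (Set.uIoc_subset_uIcc hx)).2
  have hlin : HasDerivAt (fun s => (L s - L t) * F (L t, t)) (a * F (L t, t)) t :=
    (hL.sub_const _).mul_const _
  have hrem : HasDerivAt
      (fun s => (∫ x in (L t)..(L s), F (x, s)) - (L s - L t) * F (L t, t)) 0 t := by
    rw [hasDerivAt_iff_isLittleO]
    simpa using hsmall.trans_isBigO hL.isBigO_sub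
  simpa using hrem.fun_add hlin

open Filter Topology in
/-- Differentiation under the integral sign for a function that is `C¹` near the segment. -/
lemma hasDerivAt_integral_of_contDiffOn {F : ℝ × ℝ → ℝ} {U : Set (ℝ × ℝ)} (hU : IsOpen U)
    (hF : ContDiffOn ℝ 1 F U) {a b t : ℝ} (hseg : ∀ x ∈ Set.uIcc a b, (x, t) ∈ U) :
    HasDerivAt (fun s => ∫ x in a..b, F (x, s))
      (∫ x in a..b, fderiv ℝ F (x, t) (0, 1)) t := by
  obtain ⟨V, W, -, hW, hV, htW, hVW⟩ := generalized_tube_lemma (isCompact_uIcc (a := a) (b := b))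
    (isCompact_singleton (x := t)) hU (by rintro ⟨x, s⟩ ⟨hx, rfl⟩; exact hseg x hx)
  obtain ⟨r, hr, hrW⟩ := Metric.nhds_basis_closedBall.mem_iff.1 (hW.mem_nhds (htW rfl))
  have hsub : Set.uIcc a b ×ˢ Metric.closedBall t r ⊆ U := fun z hz => hVW ⟨hV hz.1, hrW hz.2⟩
  have hdF : ContinuousOn (fun z => fderiv ℝ F z (0, 1)) U :=
    (hF.continuousOn_fderiv_of_isOpen hU le_rfl).clm_apply continuousOn_const
  obtain ⟨C, hC⟩ := (isCompact_uIcc.prod (isCompact_closedBall t r)).exists_bound_of_continuousOn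
    (hdF.mono hsub)
  have hslice {G : ℝ × ℝ → ℝ} (hG : ContinuousOn G U) {s : ℝ} (hs : s ∈ Metric.closedBall t r) :
      ContinuousOn (fun x => G (x, s)) (Set.uIcc a b) :=
    hG.comp (by fun_prop) fun x hx => hsub ⟨hx, hs⟩
  have htr := Metric.mem_closedBall_self (x := t) hr.le
  refine (intervalIntegral.hasDerivAt_integral_of_dominated_loc_of_deriv_le
    (F := fun s x => F (x, s)) (F' := fun s x => fderiv ℝ F (x, s) (0, 1)) (bound := fun _ => C)
    (Metric.closedBall_mem_nhds t hr) ?_ (hslice hF.continuousOn htr).intervalIntegrable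
    (hslice hdF htr).intervalIntegrable.def'.aestronglyMeasurable ?_ intervalIntegrable_const ?_).2
  · filter_upwards [Metric.closedBall_mem_nhds t hr] with s hs
    exact (hslice hF.continuousOn hs).intervalIntegrable.def'.aestronglyMeasurable
  · exact .of_forall fun x hx s hs => hC (x, s) ⟨Set.uIoc_subset_uIcc hx, hs⟩
  · refine .of_forall fun x hx s hs => ?_
    have hz : (x, s) ∈ U := hsub ⟨Set.uIoc_subset_uIcc hx, hs⟩
    have hd := ((hF.differentiableOn one_ne_zero).differentiableAt (hU.mem_nhds hz)).hasFDerivAt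
    exact hd.comp_hasDerivAt s ((hasDerivAt_const s x).prodMk (hasDerivAt_id s))

open Filter Topology in
/-- The Leibniz integral rule with one moving endpoint. -/
lemma hasDerivAt_integral_leibniz {F : ℝ × ℝ → ℝ} {U : Set (ℝ × ℝ)} (hU : IsOpen U)
    (hF : ContDiffOn ℝ 1 F U) {L : ℝ → ℝ} {a c t : ℝ} (hL : HasDerivAt L a t)
    (hseg : ∀ x ∈ Set.uIcc c (L t), (x, t) ∈ U) :
    HasDerivAt (fun s => ∫ x in c..(L s), F (x, s))
      ((∫ x in c..(L t), fderiv ℝ F (x, t) (0, 1)) + a * F (L t, t)) t := by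
  have hLt := hseg _ Set.right_mem_uIcc
  refine ((hasDerivAt_integral_of_contDiffOn hU hF hseg).add
    (hasDerivAt_integral_moving_endpoint hU hF.continuousOn hL hLt)).congr_of_eventuallyEq ?_
  obtain ⟨V, W, -, hW, hV, htW, hVW⟩ := generalized_tube_lemma
    (isCompact_uIcc (a := c) (b := L t)) (isCompact_singleton (x := t)) hU
    (by rintro ⟨x, s⟩ ⟨hx, rfl⟩; exact hseg x hx)
  filter_upwards [hW.mem_nhds (htW rfl), eventually_forall_uIcc_of_eventually_nhds hL.continuousAt
    (hU.mem_nhds hLt)] with s hsW hs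
  refine (intervalIntegral.integral_add_adjacent_intervals ?_ ?_).symm
  · exact (hF.continuousOn.comp (by fun_prop) fun x hx => hVW ⟨hV hx, hsW⟩).intervalIntegrable
  · exact (hF.continuousOn.comp (by fun_prop) fun x hx => hs x hx).intervalIntegrable

lemma hasDerivAt_slice_fst {F : ℝ × ℝ → ℝ} {x t : ℝ} (h : DifferentiableAt ℝ F (x, t)) :
    HasDerivAt (fun y => F (y, t)) (fderiv ℝ F (x, t) (1, 0)) x :=
  h.hasFDerivAt.comp_hasDerivAt x ((hasDerivAt_id x).prodMk (hasDerivAt_const x t))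

lemma hasDerivAt_slice_snd {F : ℝ × ℝ → ℝ} {x t : ℝ} (h : DifferentiableAt ℝ F (x, t)) :
    HasDerivAt (fun s => F (x, s)) (fderiv ℝ F (x, t) (0, 1)) t :=
  h.hasFDerivAt.comp_hasDerivAt t ((hasDerivAt_const t x).prodMk (hasDerivAt_id t))

/-- If `f` solves the wave equation at a point, there the time derivative of the energy
density `f_t² + f_x²` is `2 (f_t f_x)_x`. -/
lemma fderiv_energy_density {f : ℝ × ℝ → ℝ} {x t : ℝ} (hf : ContDiffAt ℝ 2 f (x, t))
    (hwave : fderiv ℝ (fun z => fderiv ℝ f z (0, 1)) (x, t) (0, 1)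
      = fderiv ℝ (fun z => fderiv ℝ f z (1, 0)) (x, t) (1, 0)) :
    fderiv ℝ (fun z => fderiv ℝ f z (0, 1) ^ 2 + fderiv ℝ f z (1, 0) ^ 2) (x, t) (0, 1)
      = 2 * fderiv ℝ (fun z => fderiv ℝ f z (0, 1) * fderiv ℝ f z (1, 0)) (x, t) (1, 0) := by
  have hD : DifferentiableAt ℝ (fderiv ℝ f) (x, t) :=
    (hf.fderiv_right (m := 1) (by norm_num)).differentiableAt one_ne_zero
  have hv (v : ℝ × ℝ) : HasFDerivAt (fun z => fderiv ℝ f z v)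
      ((fderiv ℝ (fderiv ℝ f) (x, t)).flip v) (x, t) := by
    simpa using hD.hasFDerivAt.clm_apply (hasFDerivAt_const v (x, t))
  have hsymm := hf.isSymmSndFDerivAt (by simp) (0, 1) (1, 0)
  rw [(hv _).fderiv, (hv _).fderiv] at hwave
  rw [(((hv (0, 1)).pow 2).fun_add ((hv (1, 0)).pow 2)).fderiv,
    ((hv (0, 1)).fun_mul (hv (1, 0))).fderiv]
  simp only [ContinuousLinearMap.flip_apply, add_apply,
    smul_apply, smul_eq_mul] at hwave ⊢
  rw [hwave, hsymm]
  simp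
  ring

/-- The boundary flux is nonpositive under the damped condition on an expanding interval. -/
lemma boundary_flux_nonpos {a η p q : ℝ} (hη : 0 < η) (ha0 : 0 ≤ a) (ha1 : a < 1)
    (hbc : (1 + η * a) * p + (η + a) * q = 0) :
    q * p + 1 / 2 * (a * (q ^ 2 + p ^ 2)) ≤ 0 := by
  have hk : 0 < 1 + η * a := by positivity
  have hp : p = -((η + a) / (1 + η * a)) * q := by
    field_simp
    linarith
  have hval : q * p + 1 / 2 * (a * (q ^ 2 + p ^ 2))
      = -((1 - a ^ 2) * (a * (1 + η ^ 2) + 2 * η) * q ^ 2 / (2 * (1 + η * a) ^ 2)) := by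
    rw [hp]
    field_simp
    ring
  rw [hval, neg_nonpos]
  have : 0 ≤ 1 - a ^ 2 := by nlinarith
  positivity

open Filter Topology in

theorem damped_expanding_energy_decay
    (ℓ ℓ' : ℝ → ℝ)
    (hℓC1 : ContDiffOn ℝ 1 ℓ (Set.Ici 0))
    (hℓd : ∀ t ∈ Set.Ici (0:ℝ), HasDerivWithinAt ℓ (ℓ' t) (Set.Ici 0) t)
    (hℓpos : ∀ t ∈ Set.Ici (0:ℝ), 0 < ℓ t)
    (hℓspeed : ∀ t ∈ Set.Ici (0:ℝ), |ℓ' t| < 1)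
    (u : ℝ → ℝ → ℝ) (U : Set (ℝ × ℝ)) (hUopen : IsOpen U)
    (hUK : {p : ℝ × ℝ | 0 ≤ p.2 ∧ p.1 ∈ Set.Icc 0 (ℓ p.2)} ⊆ U)
    (huC2 : ContDiffOn ℝ 2 (fun p : ℝ × ℝ => u p.1 p.2) U)
    (hwave : ∀ x t : ℝ, 0 ≤ t → x ∈ Set.Icc 0 (ℓ t) →
      deriv (deriv (u x)) t = deriv (deriv (fun y => u y t)) x)
    (hbc0 : ∀ t : ℝ, 0 ≤ t → u 0 t = 0)
    (η : ℝ) (hη0 : 0 < η) (hη1 : η ≠ 1)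
    (hbcℓ : ∀ t : ℝ, 0 < t →
      (1 + η * ℓ' t) * deriv (fun y => u y t) (ℓ t)
        + (η + ℓ' t) * deriv (u (ℓ t)) t = 0)
    (E : ℝ → ℝ)
    (hE : ∀ t : ℝ, E t = (1/2) * ∫ x in (0:ℝ)..(ℓ t),
      ((deriv (u x) t)^2 + (deriv (fun y => u y t) x)^2))
    (t₁ t₂ : ℝ) (ht₁ : 0 < t₁)
    (hexp : ∀ t ∈ Set.Icc t₁ t₂, 0 ≤ ℓ' t ∧ ℓ' t < 1)
    : (∀ t ∈ Set.Icc t₁ t₂, deriv E t ≤ 0) ∧ AntitoneOn E (Set.Icc t₁ t₂) := by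
  set f : ℝ × ℝ → ℝ := fun p => u p.1 p.2 with hf
  set P : ℝ × ℝ → ℝ := fun z => fderiv ℝ f z (1, 0) with hP
  set Q : ℝ × ℝ → ℝ := fun z => fderiv ℝ f z (0, 1) with hQ
  have hD : ContDiffOn ℝ 1 (fderiv ℝ f) U := huC2.fderiv_of_isOpen hUopen (by norm_num)
  have hPC : ContDiffOn ℝ 1 P U := hD.clm_apply contDiffOn_const
  have hQC : ContDiffOn ℝ 1 Q U := hD.clm_apply contDiffOn_const
  have hdiff {G : ℝ × ℝ → ℝ} (hG : ContDiffOn ℝ 1 G U) {z : ℝ × ℝ} (hz : z ∈ U) :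
      DifferentiableAt ℝ G z :=
    (hG.differentiableOn one_ne_zero).differentiableAt (hUopen.mem_nhds hz)
  have hfC : ContDiffOn ℝ 1 f U := huC2.of_le (by norm_num)
  have hux {x t : ℝ} (hz : (x, t) ∈ U) : deriv (fun y => u y t) x = P (x, t) :=
    (hasDerivAt_slice_fst (hdiff hfC hz)).deriv
  have hut {x t : ℝ} (hz : (x, t) ∈ U) : deriv (u x) t = Q (x, t) :=
    (hasDerivAt_slice_snd (hdiff hfC hz)).deriv
  have hmem {x t : ℝ} (ht : 0 ≤ t) (hx : x ∈ Set.Icc 0 (ℓ t)) : (x, t) ∈ U := hUK ⟨ht, hx⟩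
  have hwave' {x t : ℝ} (ht : 0 ≤ t) (hx : x ∈ Set.Icc 0 (ℓ t)) :
      fderiv ℝ Q (x, t) (0, 1) = fderiv ℝ P (x, t) (1, 0) := by
    have hz := hmem ht hx
    have hnear := hUopen.mem_nhds hz
    have htt : deriv (u x) =ᶠ[𝓝 t] fun s => Q (x, s) := by
      have hc : ContinuousAt (fun s : ℝ => (x, s)) t := by fun_prop
      filter_upwards [hc hnear] with s hs using hut hs
    have hxx : deriv (fun y => u y t) =ᶠ[𝓝 x] fun y => P (y, t) := by
      have hc : ContinuousAt (fun y : ℝ => (y, t)) x := by fun_prop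
      filter_upwards [hc hnear] with y hy using hux hy
    rw [← (hasDerivAt_slice_snd (hdiff hQC hz)).deriv, ← (hasDerivAt_slice_fst (hdiff hPC hz)).deriv,
      ← htt.deriv_eq, ← hxx.deriv_eq]
    exact hwave x t ht hx
  have hE' {t : ℝ} (ht : 0 < t) : HasDerivAt E
      (Q (ℓ t, t) * P (ℓ t, t) + 1 / 2 * (ℓ' t * (Q (ℓ t, t) ^ 2 + P (ℓ t, t) ^ 2))) t := by
    have hℓt : HasDerivAt ℓ (ℓ' t) t := (hℓd t ht.le).hasDerivAt (Ici_mem_nhds ht)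
    have hIcc : Set.uIcc 0 (ℓ t) = Set.Icc 0 (ℓ t) := Set.uIcc_of_le (hℓpos t ht.le).le
    have hseg : ∀ x ∈ Set.uIcc 0 (ℓ t), (x, t) ∈ U := fun x hx => hmem ht.le (hIcc ▸ hx)
    have hQPC : ContDiffOn ℝ 1 (fun z => Q z * P z) U := hQC.mul hPC
    have hQ0 : Q (0, t) = 0 := by
      rw [← hut (hseg 0 Set.left_mem_uIcc)]
      have h0 : u 0 =ᶠ[𝓝 t] fun _ => 0 := by
        filter_upwards [Ioi_mem_nhds ht] with s hs using hbc0 s (le_of_lt hs)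
      simp [h0.deriv_eq]
    have hflux : ∫ x in (0 : ℝ)..(ℓ t), fderiv ℝ (fun z => Q z ^ 2 + P z ^ 2) (x, t) (0, 1)
        = 2 * (Q (ℓ t, t) * P (ℓ t, t)) := by
      rw [intervalIntegral.integral_congr (g := fun x =>
        2 * fderiv ℝ (fun z => Q z * P z) (x, t) (1, 0)) fun x hx => fderiv_energy_density
          (huC2.contDiffAt (hUopen.mem_nhds (hseg x hx))) (hwave' ht.le (hIcc ▸ hx)),
        intervalIntegral.integral_const_mul, intervalIntegral.integral_eq_sub_of_hasDerivAt
          (fun x hx => hasDerivAt_slice_fst (hdiff hQPC (hseg x hx)))]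
      · simp [hQ0]
      · have hc : ContinuousOn (fun z => fderiv ℝ (fun z => Q z * P z) z (1, 0)) U :=
          (hQPC.continuousOn_fderiv_of_isOpen hUopen le_rfl).clm_apply continuousOn_const
        exact (hc.comp (f := fun x : ℝ => (x, t)) (by fun_prop) hseg).intervalIntegrable
    have hmain := (hasDerivAt_integral_leibniz hUopen ((hQC.pow 2).add (hPC.pow 2)) hℓt
      hseg).const_mul (1 / 2 : ℝ)
    rw [hflux] at hmain
    refine (hmain.congr_deriv (by ring)).congr_of_eventuallyEq ?_
    filter_upwards [Ioi_mem_nhds ht] with s hs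
    have hs : 0 < s := hs
    rw [hE]
    congr 1
    refine intervalIntegral.integral_congr fun x hx => ?_
    have hz := hmem hs.le (Set.uIcc_of_le (hℓpos s hs.le).le ▸ hx)
    simp only [hux hz, hut hz]
  have hnonpos : ∀ t ∈ Set.Icc t₁ t₂, deriv E t ≤ 0 := fun t ht => by
    have ht0 : 0 < t := ht₁.trans_le ht.1
    rw [(hE' ht0).deriv]
    have hz : (ℓ t, t) ∈ U := hmem ht0.le (Set.right_mem_Icc.2 (hℓpos t ht0.le).le)
    refine boundary_flux_nonpos hη0 (hexp t ht).1 (hexp t ht).2 ?_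
    rw [← hux hz, ← hut hz]
    exact hbcℓ t ht0
  have hdiffE : ∀ t ∈ Set.Icc t₁ t₂, DifferentiableAt ℝ E t := fun t ht =>
    (hE' (ht₁.trans_le ht.1)).differentiableAt
  refine ⟨hnonpos, antitoneOn_of_deriv_nonpos (convex_Icc t₁ t₂)
    (fun t ht => (hdiffE t ht).continuousAt.continuousWithinAt)
    (fun t ht => (hdiffE t (interior_subset ht)).differentiableWithinAt)
    fun t ht => hnonpos t (interior_subset ht)⟩
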